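/- Let H be a minimal counterexample to the main theorem: a plane graph with Δ(H)=6, containing no subgraph isomorphic to a diamond or a house, in which every 6-vertex either is not incident with two 4-cycles sharing an edge or is not incident with three cycles of sizes p,q,ℓ for any {p,q,ℓ} ∈ {{3,4,4},{3,3,4}}, that is not totally 7-colorable, and that minimizes |V(H)|+|E(H)| among all such graphs. Then H contains no vertex v of degree 6 with three distinct neighbors x1, x2, x3, each of degree exactly 2 in H, such that the neighbor u1 of x1 other than v and the neighbor u2 of x2 other than v are adjacent in H. -/

import Mathlib

open SimpleGraph

/-- The degree of a vertex, as `Nat.card` of its neighbor set. -/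
noncomputable def vdeg {V : Type*} (G : SimpleGraph V) (v : V) : ℕ :=
  Nat.card (G.neighborSet v)

/-- `G` has maximum degree exactly `k`. -/
def MaxDegreeEq {V : Type*} (G : SimpleGraph V) (k : ℕ) : Prop :=
  (∀ v, vdeg G v ≤ k) ∧ ∃ v, vdeg G v = k

/-- `G` admits a total `k`-coloring: a coloring of vertices and edges with `k` colors such
that adjacent vertices get distinct colors, edges sharing an endpoint get distinct colors,
and each edge gets a color distinct from those of its endpoints. -/
def TotallyColorable {V : Type*} (G : SimpleGraph V) (k : ℕ) : Prop :=
  ∃ (cv : V → Fin k) (ce : Sym2 V → Fin k),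
    (∀ ⦃u v⦄, G.Adj u v → cv u ≠ cv v) ∧
    (∀ e₁ ∈ G.edgeSet, ∀ e₂ ∈ G.edgeSet, e₁ ≠ e₂ → (∃ x, x ∈ e₁ ∧ x ∈ e₂) →
      ce e₁ ≠ ce e₂) ∧
    (∀ ⦃u v⦄, G.Adj u v → ce s(u, v) ≠ cv u)

/-- The diamond: `K₄` minus one edge. -/
def diamondGraph : SimpleGraph (Fin 4) :=
  SimpleGraph.fromEdgeSet {s(0, 1), s(0, 2), s(0, 3), s(1, 2), s(1, 3)}

/-- The house: a `4`-cycle `1 2 3 4` and a triangle `0 1 4` sharing exactly the edge `{1,4}`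
(equivalently, a `5`-cycle plus one chord). -/
def houseGraph : SimpleGraph (Fin 5) :=
  SimpleGraph.fromEdgeSet {s(0, 1), s(1, 2), s(2, 3), s(3, 4), s(4, 0), s(1, 4)}

/-- `G` contains a (not necessarily induced) subgraph isomorphic to `H`. -/
def ContainsCopy {α β : Type*} (H : SimpleGraph α) (G : SimpleGraph β) : Prop :=
  ∃ f : α → β, Function.Injective f ∧ ∀ ⦃u v⦄, H.Adj u v → G.Adj (f u) (f v)

/-- `v` is incident with two distinct `4`-cycles of `G` that share an edge. -/
def TwoAdjacentFourCyclesAt {V : Type*} (G : SimpleGraph V) (v : V) : Prop :=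
  ∃ (c₁ c₂ : G.Walk v v), c₁.IsCycle ∧ c₂.IsCycle ∧ c₁.length = 4 ∧ c₂.length = 4 ∧
    {e | e ∈ c₁.edges} ≠ {e | e ∈ c₂.edges} ∧ ∃ e, e ∈ c₁.edges ∧ e ∈ c₂.edges

/-- `v` is incident with three pairwise distinct cycles of `G`, of lengths `p`, `q`, `ℓ`. -/
def ThreeCyclesAt {V : Type*} (G : SimpleGraph V) (v : V) (p q ℓ : ℕ) : Prop :=
  ∃ (c₁ c₂ c₃ : G.Walk v v), c₁.IsCycle ∧ c₂.IsCycle ∧ c₃.IsCycle ∧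
    c₁.length = p ∧ c₂.length = q ∧ c₃.length = ℓ ∧
    {e | e ∈ c₁.edges} ≠ {e | e ∈ c₂.edges} ∧
    {e | e ∈ c₁.edges} ≠ {e | e ∈ c₃.edges} ∧
    {e | e ∈ c₂.edges} ≠ {e | e ∈ c₃.edges}

/-- Every `6`-vertex of `G` is not incident with two `4`-cycles sharing an edge, or is not
incident with three cycles of sizes `p, q, ℓ` for any `{p,q,ℓ} ∈ {{3,4,4},{3,3,4}}`. -/
def Good6Vertices {V : Type*} (G : SimpleGraph V) : Prop :=
  ∀ v, vdeg G v = 6 →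
    (¬ TwoAdjacentFourCyclesAt G v) ∨
    (∀ p q ℓ : ℕ, (({p, q, ℓ} : Multiset ℕ) = {3, 4, 4} ∨ ({p, q, ℓ} : Multiset ℕ) = {3, 3, 4}) →
      ¬ ThreeCyclesAt G v p q ℓ)

/-- Reversal of darts, as a permutation. -/
def dartRev {V : Type*} (G : SimpleGraph V) : Equiv.Perm G.Dart :=
  Function.Involutive.toPerm SimpleGraph.Dart.symm SimpleGraph.Dart.symm_involutive

/-- A rotation system (combinatorial embedding) of `G`: a permutation of the darts whose
orbits are exactly the sets of darts emanating from each single vertex. -/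
structure RotationSystem {V : Type*} (G : SimpleGraph V) where
  σ : Equiv.Perm G.Dart
  tail_fixed : ∀ d : G.Dart, (σ d).fst = d.fst
  vertex_cycles : ∀ d d' : G.Dart, d.fst = d'.fst → σ.SameCycle d d'

namespace RotationSystem

variable {V : Type*} {G : SimpleGraph V}

/-- The face-tracing permutation of a rotation system. -/
def φ (R : RotationSystem G) : Equiv.Perm G.Dart :=
  R.σ * dartRev G

/-- Two darts lie on the same face iff they are in the same orbit of the face-tracing
permutation. -/
def faceSetoid (R : RotationSystem G) : Setoid G.Dart where
  r := R.φ.SameCycle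
  iseqv := ⟨fun d => Equiv.Perm.SameCycle.refl _ d, Equiv.Perm.SameCycle.symm,
    Equiv.Perm.SameCycle.trans⟩

/-- The faces of the embedding: orbits of the face-tracing permutation. -/
def Faces (R : RotationSystem G) : Type _ :=
  Quotient R.faceSetoid

/-- The number of faces of the embedding. -/
noncomputable def numFaces (R : RotationSystem G) : ℕ :=
  Nat.card R.Faces

/-- The darts of the face containing the dart `d`. -/
def faceDarts (R : RotationSystem G) (d : G.Dart) : Set G.Dart :=
  {d' | R.φ.SameCycle d d'}

/-- The degree (length of the boundary walk, cut edges counted twice) of the face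
containing the dart `d`. -/
noncomputable def faceDeg (R : RotationSystem G) (d : G.Dart) : ℕ :=
  (R.faceDarts d).ncard

/-- The vertex `v` is incident with the face containing the dart `d`. -/
def FaceIncident (R : RotationSystem G) (v : V) (d : G.Dart) : Prop :=
  ∃ d' ∈ R.faceDarts d, d'.fst = v

/-- A rotation system is a plane embedding when it satisfies Euler's formula
`|V| - |E| + |F| = 2` on each connected component, i.e. `|V| + |F| = |E| + 2c`. -/
def IsPlanarEmbedding [Fintype V] (R : RotationSystem G) : Prop :=
  Fintype.card V + R.numFaces = Nat.card G.edgeSet + 2 * Nat.card G.ConnectedComponent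

end RotationSystem

/-- A graph is planar if it admits a plane embedding. -/
def IsPlanar {V : Type*} [Fintype V] (G : SimpleGraph V) : Prop :=
  ∃ R : RotationSystem G, R.IsPlanarEmbedding

/-- Conditions (1), (2), (3) on graphs in Theorem 1: planar of maximum degree 6, with no
diamond and no house subgraph, and every 6-vertex not incident with two adjacent 4-cycles
or not incident with three cycles of sizes in `{{3,4,4},{3,3,4}}`. -/
def GoodGraph {V : Type*} [Fintype V] (G : SimpleGraph V) : Prop :=
  IsPlanar G ∧ MaxDegreeEq G 6 ∧ ¬ ContainsCopy diamondGraph G ∧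
    ¬ ContainsCopy houseGraph G ∧ Good6Vertices G

/-- `H` is a minimal counterexample to the main theorem: it satisfies conditions (1)–(3),
is not totally 7-colorable, and minimizes `|V| + |E|` among all such graphs. -/
def MinimalCounterexample {V : Type*} [Fintype V] (H : SimpleGraph V) : Prop :=
  GoodGraph H ∧ ¬ TotallyColorable H 7 ∧
    ∀ (n : ℕ) (G : SimpleGraph (Fin n)), GoodGraph G → ¬ TotallyColorable G 7 →
      Fintype.card V + Nat.card H.edgeSet ≤ n + Nat.card G.edgeSet

namespace PM
set_option linter.unusedSectionVars false
open Equiv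

variable {D : Type*}

/-- cycles as a setoid -/
def cyc (π : Perm D) : Setoid D where
  r := π.SameCycle
  iseqv := ⟨fun d => Equiv.Perm.SameCycle.refl _ d, Equiv.Perm.SameCycle.symm,
    Equiv.Perm.SameCycle.trans⟩

noncomputable def nc (r : Setoid D) : ℕ := Nat.card (Quotient r)

def jn (r : Setoid D) (a b : D) : Setoid D where
  r x y := r x y ∨ ((r x a ∨ r x b) ∧ (r y a ∨ r y b))
  iseqv := by
    refine ⟨fun x => Or.inl (r.refl x), ?_, ?_⟩
    · rintro x y (h | h)
      · exact Or.inl (r.symm h)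
      · exact Or.inr ⟨h.2, h.1⟩
    · rintro x y z (h | h) (k | k)
      · exact Or.inl (r.trans h k)
      · exact Or.inr ⟨k.1.imp (r.trans h) (r.trans h), k.2⟩
      · exact Or.inr ⟨h.1, h.2.imp (r.trans (r.symm k)) (r.trans (r.symm k))⟩
      · exact Or.inr ⟨h.1, k.2⟩

theorem le_jn (r : Setoid D) (a b : D) : r ≤ jn r a b := fun _ _ h => Or.inl h

theorem jn_ab (r : Setoid D) (a b : D) : jn r a b a b :=
  Or.inr ⟨Or.inl (r.refl a), Or.inr (r.refl b)⟩

theorem jn_le {r s : Setoid D} {a b : D} (h : r ≤ s) (hab : s a b) : jn r a b ≤ s := by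
  rintro x y (k | ⟨k1 | k1, k2 | k2⟩)
  · exact h k
  · exact s.trans (h k1) (s.symm (h k2))
  · exact s.trans (h k1) (s.trans hab (s.symm (h k2)))
  · exact s.trans (h k1) (s.trans (s.symm hab) (s.symm (h k2)))
  · exact s.trans (h k1) (s.symm (h k2))

theorem nc_mono [Finite D] {r s : Setoid D} (h : r ≤ s) : nc s ≤ nc r := by
  refine Nat.card_le_card_of_surjective (Quotient.map' (s₁ := r) (s₂ := s) id (fun a b k => h k)) ?_
  rintro ⟨x⟩
  exact ⟨Quotient.mk r x, rfl⟩

theorem nc_jn_add [Finite D] (r : Setoid D) (a b : D) : nc r ≤ nc (jn r a b) + 1 := by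
  classical
  have : nc (jn r a b) + 1 = Nat.card (Option (Quotient (jn r a b))) := by
    rw [Finite.card_option]; rfl
  rw [this]
  refine Nat.card_le_card_of_injective
    (fun q : Quotient r => if q = Quotient.mk r a then none else
      some (Quotient.map' (s₁ := r) (s₂ := jn r a b) id (fun a b k => Or.inl k) q)) ?_
  rintro ⟨x⟩ ⟨y⟩ h
  change (if Quotient.mk r x = Quotient.mk r a then none else
      some (Quotient.mk (jn r a b) x)) = (if Quotient.mk r y = Quotient.mk r a then none else
      some (Quotient.mk (jn r a b) y)) at h
  change Quotient.mk r x = Quotient.mk r y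
  by_cases hx : Quotient.mk r x = Quotient.mk r a <;> by_cases hy : Quotient.mk r y = Quotient.mk r a
  · rw [hx, hy]
  · simp [hx, hy] at h
  · simp [hx, hy] at h
  · rw [if_neg hx, if_neg hy] at h
    have h2 := Quotient.exact (Option.some.inj h)
    have hx' : ¬ r x a := fun k => hx (Quotient.sound k)
    have hy' : ¬ r y a := fun k => hy (Quotient.sound k)
    apply Quotient.sound
    rcases h2 with h | ⟨h1 | h1, h2 | h2⟩
    · exact h
    · exact absurd h1 hx'
    · exact absurd h1 hx'
    · exact absurd h2 hy'
    · exact r.trans h1 (r.symm h2)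

theorem nc_jn_lt [Finite D] {r : Setoid D} {a b : D} (h : ¬ r a b) : nc (jn r a b) + 1 ≤ nc r := by
  refine Nat.succ_le_of_lt ?_
  have := Fintype.ofFinite (Quotient r)
  have := Fintype.ofFinite (Quotient (jn r a b))
  unfold nc
  rw [Nat.card_eq_fintype_card, Nat.card_eq_fintype_card]
  refine Fintype.card_lt_of_surjective_not_injective
    (Quotient.map' (s₁ := r) (s₂ := jn r a b) id (fun a b k => Or.inl k)) ?_ ?_
  · rintro ⟨x⟩
    exact ⟨Quotient.mk r x, rfl⟩
  · intro hi
    have : Quotient.mk r a = Quotient.mk r b := hi (Quotient.sound (jn_ab r a b))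
    exact h (Quotient.exact this)

theorem cyc_le {ρ : Perm D} {s : Setoid D} (h : ∀ x, s x (ρ x)) : cyc ρ ≤ s := by
  rintro x y ⟨n, rfl⟩
  have nat : ∀ (n : ℕ) x, s x ((ρ ^ n) x) := by
    intro n
    induction n with
    | zero => intro x; exact s.refl x
    | succ n ih => intro x; rw [pow_succ]; exact s.trans (h x) (ih (ρ x))
  obtain ⟨n, rfl | rfl⟩ := n.eq_nat_or_neg
  · exact nat n x
  · have := nat n ((ρ ^ (-(n:ℤ))) x)
    apply s.symm
    convert this using 1
    rw [← zpow_natCast, ← Perm.mul_apply, ← zpow_add]; simp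

theorem cyc_apply (ρ : Perm D) (x : D) : cyc ρ x (ρ x) := ⟨1, by simp⟩

variable [DecidableEq D]

theorem cyc_swap_le (π : Perm D) (a b : D) : cyc (π * swap a b) ≤ jn (cyc π) a b := by
  apply cyc_le
  intro x
  rw [Perm.mul_apply]
  by_cases hx : x = a
  · subst hx; rw [swap_apply_left]
    exact Or.inr ⟨Or.inl ((cyc π).refl _), Or.inr ((cyc π).symm (cyc_apply π b))⟩
  by_cases hx2 : x = b
  · subst hx2; rw [swap_apply_right]
    exact Or.inr ⟨Or.inr ((cyc π).refl _), Or.inl ((cyc π).symm (cyc_apply π a))⟩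
  rw [swap_apply_of_ne_of_ne hx hx2]
  exact Or.inl (cyc_apply π x)

theorem cyc_le_swap (π : Perm D) (a b : D) : cyc π ≤ jn (cyc (π * swap a b)) a b := by
  have := cyc_swap_le (π * swap a b) a b
  rwa [mul_assoc, swap_mul_self, mul_one] at this

theorem cyc_joined [Finite D] {π : Perm D} {a b : D} (h : ¬ cyc π a b) : cyc (π * swap a b) a b := by
  by_contra hb
  set ρ := π * swap a b with hρ
  have key : ∀ n : ℕ, cyc ρ a ((π ^ n) (π b)) ∧ cyc π b ((π ^ n) (π b)) := by
    intro n
    induction n with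
    | zero =>
      refine ⟨?_, cyc_apply π b⟩
      have := cyc_apply ρ a
      rwa [hρ, Perm.mul_apply, swap_apply_left, ← hρ] at this
    | succ n ih =>
      rw [pow_succ', Perm.mul_apply]
      set y := (π ^ n) (π b)
      have hya : y ≠ a := by
        intro e; rw [e] at ih; exact h ((cyc π).symm ih.2)
      have hyb : y ≠ b := by
        intro e; rw [e] at ih; exact hb ih.1
      refine ⟨(cyc ρ).trans ih.1 ?_, (cyc π).trans ih.2 (cyc_apply π y)⟩
      have := cyc_apply ρ y
      rwa [hρ, Perm.mul_apply, swap_apply_of_ne_of_ne hya hyb, ← hρ] at this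
  have h2 : π.SameCycle (π b) b := (cyc π).symm (cyc_apply π b)
  obtain ⟨n, hn⟩ := h2.exists_nat_pow_eq
  have := (key n).1
  rw [hn] at this
  exact hb this

theorem z_swap_le [Finite D] (π : Perm D) (a b : D) : nc (cyc (π * swap a b)) ≤ nc (cyc π) + 1 :=
  (nc_jn_add _ a b).trans (Nat.add_le_add_right (nc_mono (cyc_le_swap π a b)) 1)

theorem z_swap_lt [Finite D] {π : Perm D} {a b : D} (h : ¬ cyc π a b) :
    nc (cyc (π * swap a b)) + 1 ≤ nc (cyc π) := by
  have h1 : jn (cyc π) a b ≤ cyc (π * swap a b) := by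
    have h0 := cyc_joined h
    refine jn_le ?_ h0
    refine (cyc_le_swap π a b).trans (jn_le le_rfl h0)
  exact (Nat.add_le_add_right (nc_mono h1) 1).trans (nc_jn_lt h)

/-- defect -/
noncomputable def defect (σ α : Perm D) : ℤ :=
  (Nat.card D : ℤ) + 2 * nc (cyc σ ⊔ cyc α) - nc (cyc σ) - nc (cyc α) - nc (cyc (σ * α))

theorem cyc_mul_le (σ α : Perm D) : cyc (σ * α) ≤ cyc σ ⊔ cyc α := by
  apply cyc_le
  intro x
  have h1 : cyc σ ≤ cyc σ ⊔ cyc α := le_sup_left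
  have h2 : cyc α ≤ cyc σ ⊔ cyc α := le_sup_right
  exact (cyc σ ⊔ cyc α).trans (h2 (cyc_apply α x)) (h1 (cyc_apply σ (α x)))

theorem defect_mono [Finite D] (σ : Perm D) {α : Perm D} {a b : D} (h : ¬ cyc α a b) :
    defect σ α ≤ defect σ (α * swap a b) := by
  have z1 := z_swap_lt h
  have hle : cyc σ ⊔ cyc (α * swap a b) ≤ jn (cyc σ ⊔ cyc α) a b := by
    apply sup_le
    · exact le_sup_left.trans (le_jn _ a b)
    · refine (cyc_swap_le α a b).trans (jn_le (le_sup_right.trans (le_jn _ a b)) (jn_ab _ _ _))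
  have c1 := nc_mono hle
  unfold defect
  rw [← mul_assoc]
  by_cases hs : (cyc σ ⊔ cyc α) a b
  · have z2 := z_swap_le (σ * α) a b
    have c2 := nc_mono (jn_le (le_refl _) hs)
    omega
  · have z2 := z_swap_lt (π := σ * α) (a := a) (b := b) (fun k => hs (cyc_mul_le σ α k))
    have c2 := nc_jn_add (cyc σ ⊔ cyc α) a b
    omega

theorem nc_conj [Finite D] (σ α : Perm D) : nc (cyc (σ * α)) ≤ nc (cyc (α * σ)) := by
  refine Nat.card_le_card_of_surjective
    (Quotient.map' (s₁ := cyc (α * σ)) (s₂ := cyc (σ * α)) σ ?_) ?_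
  · intro x y h
    have : cyc (α * σ) ≤ Setoid.comap σ (cyc (σ * α)) := by
      apply cyc_le
      intro x
      exact cyc_apply (σ * α) (σ x)
    exact this h
  · rintro ⟨x⟩
    refine ⟨Quotient.mk _ (σ⁻¹ x), ?_⟩
    change Quotient.mk _ (σ (σ⁻¹ x)) = _
    simp; rfl

theorem defect_symm [Finite D] (σ α : Perm D) : defect σ α = defect α σ := by
  have := le_antisymm (nc_conj σ α) (nc_conj α σ)
  unfold defect
  rw [this, sup_comm]; ring

/-- remove a dart from the cycle of a permutation -/
def skip (d : D) (π : Perm D) : Perm D := π * swap d (π⁻¹ d)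

theorem skip_self (d : D) (π : Perm D) : skip d π d = d := by
  simp [skip]

theorem cyc_fix {π : Perm D} {d x : D} (h : π d = d) (hx : cyc π d x) : x = d := by
  obtain ⟨n, rfl⟩ := hx
  exact Perm.zpow_apply_eq_self_of_apply_eq_self h n

theorem skip_mul (d : D) (π : Perm D) : skip d π * swap d (π⁻¹ d) = π := by
  rw [skip, mul_assoc, swap_mul_self, mul_one]

theorem skip_fixed (d : D) (π : Perm D) {x : D} (h : π x = x) : skip d π x = x := by
  by_cases hx : x = d
  · subst hx; exact skip_self _ _
  · have : x ≠ π⁻¹ d := by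
      intro e; apply hx; rw [← h, e]; simp
    rw [skip, Perm.mul_apply, swap_apply_of_ne_of_ne hx this, h]

theorem defect_skip_right [Finite D] (d : D) (σ α : Perm D) : defect σ (skip d α) ≤ defect σ α := by
  by_cases h : α d = d
  · have : α⁻¹ d = d := by rw [Perm.inv_eq_iff_eq, h]
    rw [skip, this, swap_self, ← Perm.one_def, mul_one]
  · have := defect_mono σ (α := skip d α) (a := d) (b := α⁻¹ d) (by
      intro k
      have := cyc_fix (skip_self d α) k
      exact h (by rw [Perm.inv_eq_iff_eq] at this; exact this.symm))
    rwa [skip_mul] at this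

theorem defect_skip_left [Finite D] (d : D) (σ α : Perm D) : defect (skip d σ) α ≤ defect σ α := by
  rw [defect_symm, defect_symm σ]; exact defect_skip_right _ _ _

theorem defect_nonneg [Finite D] (σ α : Perm D) : 0 ≤ defect σ α := by
  induction hn : Set.ncard {x | α x ≠ x} using Nat.strong_induction_on generalizing α with
  | _ n ih =>
    by_cases h : ∃ d, α d ≠ d
    · obtain ⟨d, hd⟩ := h
      refine le_trans (ih _ ?_ (skip d α) rfl) (defect_skip_right d σ α)
      rw [← hn]
      apply Set.ncard_lt_ncard _ (Set.toFinite _)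
      refine ⟨fun x hx hx' => hx (skip_fixed d α hx'), fun hh => ?_⟩
      exact hh (show d ∈ {x | α x ≠ x} from hd) (skip_self d α)
    · push Not at h
      have : α = 1 := by ext x; simp [h x]
      subst this
      have h1 : nc (cyc (1 : Perm D)) = Nat.card D := by
        refine Nat.card_congr (Equiv.ofBijective (Quotient.mk (cyc (1 : Perm D))) ⟨?_, ?_⟩).symm
        · intro x y hxy
          have := Quotient.exact hxy
          exact (cyc_fix (π := 1) rfl this).symm
        · exact Quotient.exists_rep
      have h2 : cyc σ ⊔ cyc (1 : Perm D) = cyc σ := by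
        apply sup_eq_left.2
        exact cyc_le (fun x => (cyc σ).refl x)
      unfold defect
      rw [h1, h2, mul_one]; linarith

theorem cyc_skip {d : D} {π : Perm D} {x y : D} (hx : x ≠ d) (hy : y ≠ d) (h : cyc π x y) :
    cyc (skip d π) x y := by
  have := cyc_le_swap π d (π⁻¹ d) h
  change jn (cyc (skip d π)) _ _ x y at this
  have f : ∀ z, z ≠ d → ¬ cyc (skip d π) z d := fun z hz k =>
    hz (cyc_fix (skip_self d π) ((cyc _).symm k))
  rcases this with h | ⟨h1 | h1, h2 | h2⟩
  · exact h
  · exact absurd h1 (f x hx)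
  · exact absurd h1 (f x hx)
  · exact absurd h2 (f y hy)
  · exact (cyc _).trans h1 ((cyc _).symm h2)

theorem skip_inv {β : Type*} (g : D → β) (d : D) {π : Perm D} (h : ∀ x, g (π x) = g x) (x : D) :
    g (skip d π x) = g x := by
  rw [skip, Perm.mul_apply, h]
  have hi : g (π⁻¹ d) = g d := by rw [← h (π⁻¹ d)]; simp
  by_cases hx : x = d
  · subst hx; rw [swap_apply_left, hi]
  by_cases hx2 : x = π⁻¹ d
  · subst hx2; rw [swap_apply_right, hi]
  rw [swap_apply_of_ne_of_ne hx hx2]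

/-- extension of a setoid along an injection -/
def extS {D' : Type*} (ι : D' → D) (hι : Function.Injective ι) (r : Setoid D') : Setoid D where
  r x y := x = y ∨ ∃ x' y', ι x' = x ∧ ι y' = y ∧ r x' y'
  iseqv := by
    refine ⟨fun x => Or.inl rfl, ?_, ?_⟩
    · rintro x y (h | ⟨x', y', h1, h2, h3⟩)
      · exact Or.inl h.symm
      · exact Or.inr ⟨y', x', h2, h1, r.symm h3⟩
    · rintro x y z (h | ⟨x', y', h1, h2, h3⟩) (k | ⟨y'', z', k1, k2, k3⟩)
      · exact Or.inl (h.trans k)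
      · exact Or.inr ⟨y'', z', by rw [k1, h], k2, k3⟩
      · exact Or.inr ⟨x', y', h1, by rw [h2, k], h3⟩
      · have : y' = y'' := hι (h2.trans k1.symm)
        subst this
        exact Or.inr ⟨x', z', h1, k2, r.trans h3 k3⟩

theorem nc_ext [Finite D] {D' : Type*} (ι : D' → D) (hι : Function.Injective ι) (r : Setoid D') :
    nc (extS ι hι r) = nc r + Nat.card {x // x ∉ Set.range ι} := by
  have : Finite D' := Finite.of_injective ι hι
  unfold nc
  rw [← Nat.card_sum]
  symm
  refine Nat.card_congr (Equiv.ofBijective (Sum.elim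
    (Quotient.map' (s₁ := r) (s₂ := extS ι hι r) ι (fun a b k => Or.inr ⟨a, b, rfl, rfl, k⟩))
    (fun x => Quotient.mk (extS ι hι r) x.1)) ⟨?_, ?_⟩)
  · rintro (x | ⟨x, hx⟩) (y | ⟨y, hy⟩) h
    · induction x using Quotient.inductionOn with | _ x
      induction y using Quotient.inductionOn with | _ y
      have h0 : Quotient.mk (extS ι hι r) (ι x) = Quotient.mk (extS ι hι r) (ι y) := h
      rcases Quotient.exact h0 with h | ⟨x', y', h1, h2, h3⟩
      · rw [hι h]
      · have := hι h1; have := hι h2; subst x' y'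
        exact congrArg Sum.inl (Quotient.sound h3)
    · induction x using Quotient.inductionOn with | _ x
      have h0 : Quotient.mk (extS ι hι r) (ι x) = Quotient.mk (extS ι hι r) (y) := h
      rcases Quotient.exact h0 with h | ⟨x', y', h1, h2, h3⟩
      · exact absurd ⟨x, h⟩ hy
      · exact absurd ⟨y', h2⟩ hy
    · induction y using Quotient.inductionOn with | _ y
      have h0 : Quotient.mk (extS ι hι r) (x) = Quotient.mk (extS ι hι r) (ι y) := h
      rcases Quotient.exact h0 with h | ⟨x', y', h1, h2, h3⟩
      · exact absurd ⟨y, h.symm⟩ hx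
      · exact absurd ⟨x', h1⟩ hx
    · rcases Quotient.exact h with h | ⟨x', y', h1, h2, h3⟩
      · dsimp only at h; subst h; rfl
      · exact absurd ⟨x', h1⟩ hx
  · rintro ⟨x⟩
    by_cases hx : x ∈ Set.range ι
    · obtain ⟨x', rfl⟩ := hx
      exact ⟨Sum.inl (Quotient.mk _ x'), rfl⟩
    · exact ⟨Sum.inr ⟨x, hx⟩, rfl⟩

theorem cyc_le_ext {D' : Type*} {ι : D' → D} (hι : Function.Injective ι) {π : Perm D}
    {π' : Perm D'} (h : ∀ x, ι (π' x) = π (ι x)) (hf : ∀ x, x ∉ Set.range ι → π x = x) :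
    cyc π ≤ extS ι hι (cyc π') := by
  apply cyc_le
  intro x
  by_cases hx : x ∈ Set.range ι
  · obtain ⟨x', rfl⟩ := hx
    exact Or.inr ⟨x', π' x', rfl, h x', cyc_apply _ _⟩
  · rw [hf x hx]

theorem ext_le_cyc {D' : Type*} {ι : D' → D} (hι : Function.Injective ι) {π : Perm D}
    {π' : Perm D'} (h : ∀ x, ι (π' x) = π (ι x)) :
    extS ι hι (cyc π') ≤ cyc π := by
  have : cyc π' ≤ Setoid.comap ι (cyc π) := by
    apply cyc_le
    intro x
    change cyc π _ _
    rw [h]; exact cyc_apply _ _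
  rintro x y (rfl | ⟨x', y', rfl, rfl, hr⟩)
  · exact (cyc π).refl _
  · exact this hr

theorem ext_mono {D' : Type*} {ι : D' → D} (hι : Function.Injective ι) {r s : Setoid D'}
    (h : r ≤ s) : extS ι hι r ≤ extS ι hι s := by
  rintro x y (rfl | ⟨x', y', rfl, rfl, hr⟩)
  · exact Or.inl rfl
  · exact Or.inr ⟨x', y', rfl, rfl, h hr⟩

theorem defect_restrict [Finite D] {D' : Type*} [DecidableEq D'] {ι : D' → D}
    (hι : Function.Injective ι)
    {σ α : Perm D} {σ' α' : Perm D'} (hσ : ∀ x, ι (σ' x) = σ (ι x)) (hα : ∀ x, ι (α' x) = α (ι x))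
    (fσ : ∀ x, x ∉ Set.range ι → σ x = x) (fα : ∀ x, x ∉ Set.range ι → α x = x) :
    defect σ' α' ≤ defect σ α := by
  have : Finite D' := Finite.of_injective ι hι
  have z1 := nc_mono (ext_le_cyc hι hσ)
  have z2 := nc_mono (ext_le_cyc hι hα)
  have z3 := nc_mono (ext_le_cyc hι (π := σ * α) (π' := σ' * α') (by
    intro x; rw [Perm.mul_apply, hσ, hα]; rfl))
  have c := nc_mono (sup_le ((cyc_le_ext hι hσ fσ).trans (ext_mono hι (le_sup_left (b := cyc α'))))
    ((cyc_le_ext hι hα fα).trans (ext_mono hι (le_sup_right (a := cyc σ')))))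
  rw [nc_ext] at z1 z2 z3 c
  have hN : Nat.card D = Nat.card D' + Nat.card {x // x ∉ Set.range ι} := by
    classical
    rw [Nat.card_congr (Equiv.Set.sumCompl (Set.range ι)).symm, Nat.card_sum,
      Nat.card_congr (Equiv.ofInjective ι hι).symm]
    rfl
  unfold defect
  omega

end PM
namespace PM
open Equiv

theorem card_dart {V : Type*} [Finite V] (G : SimpleGraph V) :
    Nat.card G.Dart = 2 * Nat.card G.edgeSet := by
  classical
  have := Fintype.ofFinite V
  rw [Nat.card_eq_fintype_card, G.dart_card_eq_twice_card_edges, Nat.card_eq_fintype_card,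
    SimpleGraph.edgeFinset_card]

theorem dartRev_apply {V : Type*} (G : SimpleGraph V) (d : G.Dart) : dartRev G d = d.symm := rfl

theorem finite_dart {V : Type*} [Finite V] (G : SimpleGraph V) : Finite G.Dart :=
  Finite.of_injective (fun d : G.Dart => d.toProd) (fun _ _ h => SimpleGraph.Dart.ext _ _ h)

theorem z_rev {V : Type*} [Finite V] (G : SimpleGraph V) :
    nc (cyc (dartRev G)) = Nat.card G.edgeSet := by
  have hle : cyc (dartRev G) ≤ Setoid.ker (fun d : G.Dart => d.edge) := by
    apply cyc_le
    intro x
    change x.edge = (dartRev G x).edge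
    rw [dartRev_apply, SimpleGraph.Dart.edge_symm]
  refine Nat.card_congr (Equiv.ofBijective
    (Quotient.lift (s := cyc (dartRev G)) (fun d : G.Dart => (⟨d.edge, d.edge_mem⟩ : G.edgeSet))
      (fun a b h => Subtype.ext (hle h))) ⟨?_, ?_⟩)
  · rintro ⟨x⟩ ⟨y⟩ h
    have h1 : x.edge = y.edge := congrArg Subtype.val h
    apply Quotient.sound
    rcases (SimpleGraph.dart_edge_eq_iff x y).1 h1 with h | h
    · rw [h]
    · rw [h]; exact (cyc _).symm (cyc_apply (dartRev G) y)
  · rintro ⟨e, he⟩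
    induction e using Sym2.ind with
    | _ a b => exact ⟨Quotient.mk _ ⟨(a, b), he⟩, rfl⟩

abbrev Iso0 {V : Type*} (G : SimpleGraph V) := {v : V // ∀ w, ¬ G.Adj v w}

theorem z_sigma {V : Type*} [Finite V] {G : SimpleGraph V} (R : RotationSystem G) :
    nc (cyc R.σ) + Nat.card (Iso0 G) = Nat.card V := by
  have hle : cyc R.σ ≤ Setoid.ker (fun d : G.Dart => d.fst) := by
    apply cyc_le
    intro x
    exact (R.tail_fixed x).symm
  have := finite_dart G
  unfold nc
  rw [← Nat.card_sum]
  refine Nat.card_congr (Equiv.ofBijective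
    (Sum.elim (Quotient.lift (s := cyc R.σ) (fun d : G.Dart => d.fst) (fun a b h => hle h))
      (fun x : Iso0 G => x.1)) ⟨?_, ?_⟩)
  · rintro (x | ⟨x, hx⟩) (y | ⟨y, hy⟩) h
    · induction x using Quotient.inductionOn with | _ x
      induction y using Quotient.inductionOn with | _ y
      exact congrArg Sum.inl (Quotient.sound (R.vertex_cycles x y h))
    · induction x using Quotient.inductionOn with | _ x
      have h : x.fst = y := h
      exact absurd (h ▸ x.adj) (hy _)
    · induction y using Quotient.inductionOn with | _ y
      have h : x = y.fst := h
      exact absurd (h ▸ y.adj) (hx _)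
    · have h : x = y := h
      subst h; rfl
  · intro v
    by_cases hv : ∃ w, G.Adj v w
    · obtain ⟨w, hw⟩ := hv
      exact ⟨Sum.inl (Quotient.mk _ ⟨(v, w), hw⟩), rfl⟩
    · push Not at hv
      exact ⟨Sum.inr ⟨v, hv⟩, rfl⟩

theorem comp_walk {V : Type*} {G : SimpleGraph V} (R : RotationSystem G) {u v : V}
    (w : G.Walk u v) (x y : G.Dart) (hx : x.fst = u) (hy : y.fst = v) :
    (cyc R.σ ⊔ cyc (dartRev G)) x y := by
  have h1 : cyc R.σ ≤ cyc R.σ ⊔ cyc (dartRev G) := le_sup_left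
  have h2 : cyc (dartRev G) ≤ cyc R.σ ⊔ cyc (dartRev G) := le_sup_right
  induction w generalizing x with
  | nil => exact h1 (R.vertex_cycles x y (hx.trans hy.symm))
  | @cons u m v h p ih =>
    let d : G.Dart := ⟨(u, m), h⟩
    have a1 := h1 (R.vertex_cycles x d hx)
    have a2 := h2 (cyc_apply (dartRev G) d)
    exact (cyc R.σ ⊔ cyc (dartRev G)).trans a1 ((cyc R.σ ⊔ cyc (dartRev G)).trans a2 (ih _ rfl hy))

theorem z_comp {V : Type*} [Finite V] {G : SimpleGraph V} (R : RotationSystem G) :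
    nc (cyc R.σ ⊔ cyc (dartRev G)) + Nat.card (Iso0 G) = Nat.card G.ConnectedComponent := by
  have hle : cyc R.σ ⊔ cyc (dartRev G) ≤
      Setoid.ker (fun d : G.Dart => G.connectedComponentMk d.fst) := by
    apply sup_le
    · apply cyc_le
      intro x
      change G.connectedComponentMk x.fst = G.connectedComponentMk (R.σ x).fst
      rw [R.tail_fixed]
    · apply cyc_le
      intro x
      exact SimpleGraph.ConnectedComponent.sound x.adj.reachable
  have := finite_dart G
  unfold nc
  rw [← Nat.card_sum]
  have iso : ∀ x y : V, (∀ w, ¬ G.Adj x w) → G.Reachable x y → x = y := by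
    rintro x y hx ⟨w⟩
    cases w with
    | nil => rfl
    | cons h p => exact absurd h (hx _)
  refine Nat.card_congr (Equiv.ofBijective
    (Sum.elim (Quotient.lift (s := cyc R.σ ⊔ cyc (dartRev G))
      (fun d : G.Dart => G.connectedComponentMk d.fst) (fun a b h => hle h))
      (fun x : Iso0 G => G.connectedComponentMk x.1)) ⟨?_, ?_⟩)
  · rintro (x | ⟨x, hx⟩) (y | ⟨y, hy⟩) h
    · induction x using Quotient.inductionOn with | _ x
      induction y using Quotient.inductionOn with | _ y
      obtain ⟨w⟩ := SimpleGraph.ConnectedComponent.exact h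
      exact congrArg Sum.inl (Quotient.sound (comp_walk R w x y rfl rfl))
    · induction x using Quotient.inductionOn with | _ x
      have h := iso y x.fst hy (SimpleGraph.ConnectedComponent.exact h).symm
      exact absurd (h ▸ x.adj) (hy _)
    · induction y using Quotient.inductionOn with | _ y
      have h := iso x y.fst hx (SimpleGraph.ConnectedComponent.exact h)
      exact absurd (h ▸ y.adj) (hx _)
    · have h := iso x y hx (SimpleGraph.ConnectedComponent.exact h)
      subst h; rfl
  · intro C
    induction C using SimpleGraph.ConnectedComponent.ind with
    | _ v =>
    by_cases hv : ∃ w, G.Adj v w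
    · obtain ⟨w, hw⟩ := hv
      exact ⟨Sum.inl (Quotient.mk _ ⟨(v, w), hw⟩), rfl⟩
    · push Not at hv
      exact ⟨Sum.inr ⟨v, hv⟩, rfl⟩

open Classical in
theorem defect_eq {V : Type*} [Fintype V] {G : SimpleGraph V} (R : RotationSystem G) :
    defect R.σ (dartRev G) = (Nat.card G.edgeSet : ℤ) + 2 * Nat.card G.ConnectedComponent -
      Fintype.card V - R.numFaces - Nat.card (Iso0 G) := by
  have h1 := card_dart G
  have h2 := z_rev G
  have h3 := z_sigma R
  have h4 := z_comp R
  have h5 : nc (cyc (R.σ * dartRev G)) = R.numFaces := rfl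
  rw [Nat.card_eq_fintype_card (α := V)] at h3
  unfold defect
  rw [h5]
  omega

theorem perm_restrict {D D' : Type*} {ι : D' → D} (hι : Function.Injective ι) (π : Perm D)
    (h : ∀ x, x ∉ Set.range ι → π x = x) : ∃ π' : Perm D', ∀ x, ι (π' x) = π (ι x) := by
  have hp : ∀ x, x ∈ Set.range ι ↔ π x ∈ Set.range ι := by
    intro x
    constructor
    · intro hx
      by_contra hc
      have := π.injective (h _ hc)
      rw [this] at hc; exact hc hx
    · intro hx
      by_contra hc
      rw [h x hc] at hx; exact hc hx
  let e := Equiv.ofInjective ι hι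
  refine ⟨(e.trans (π.subtypePerm (fun x => (hp x).symm))).trans e.symm, fun x => ?_⟩
  change ι (e.symm _) = _
  rw [Equiv.apply_ofInjective_symm hι]
  rfl

theorem planar_delete {V : Type*} [Fintype V] {H : SimpleGraph V} (hH : IsPlanar H) {p q : V}
    (hpq : H.Adj p q) {n : ℕ} (G : SimpleGraph (Fin n)) (f : Fin n → V)
    (hf : Function.Injective f)
    (hadj : ∀ i j, G.Adj i j ↔ H.Adj (f i) (f j) ∧ s(f i, f j) ≠ s(p, q))
    (hcov : ∀ a b, H.Adj a b → s(a, b) ≠ s(p, q) → a ∈ Set.range f)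
    (hiso : ∀ i, ∃ j, G.Adj i j) : IsPlanar G := by
  classical
  obtain ⟨R, hR⟩ := hH
  have e1 := defect_eq R
  have n1 := defect_nonneg R.σ (dartRev H)
  unfold RotationSystem.IsPlanarEmbedding at hR
  let d : H.Dart := ⟨(p, q), hpq⟩
  let ι : G.Dart → H.Dart := fun x => ⟨(f x.fst, f x.snd), ((hadj _ _).1 x.adj).1⟩
  have hι : Function.Injective ι := by
    intro x y h
    have h1 : f x.fst = f y.fst := congrArg (fun d : H.Dart => d.fst) h
    have h2 : f x.snd = f y.snd := congrArg (fun d : H.Dart => d.snd) h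
    exact SimpleGraph.Dart.ext _ _ (Prod.ext (hf h1) (hf h2))
  have hr : ∀ x : H.Dart, x ∉ Set.range ι → x = d ∨ x = d.symm := by
    intro x hx
    by_contra hc
    apply hx
    have hne : s(x.fst, x.snd) ≠ s(p, q) := fun k =>
      hc ((SimpleGraph.dart_edge_eq_iff x d).1 k)
    obtain ⟨i, hi⟩ := hcov _ _ x.adj hne
    obtain ⟨j, hj⟩ := hcov _ _ x.adj.symm (by rwa [Sym2.eq_swap])
    refine ⟨⟨(i, j), (hadj _ _).2 ⟨?_, ?_⟩⟩, ?_⟩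
    · rw [hi, hj]; exact x.adj
    · rw [hi, hj]; exact hne
    · exact SimpleGraph.Dart.ext _ _ (Prod.ext hi hj)
  have hr2 : ∀ x, ι x ≠ d ∧ ι x ≠ d.symm := by
    intro x
    have := ((hadj _ _).1 x.adj).2
    constructor
    · intro k; exact this ((SimpleGraph.dart_edge_eq_iff (ι x) d).2 (Or.inl k))
    · intro k; exact this ((SimpleGraph.dart_edge_eq_iff (ι x) d).2 (Or.inr k))
  set σ' := skip d.symm (skip d R.σ) with hσ'
  set α' := skip d (dartRev H) with hα'
  have fσ : ∀ x, x ∉ Set.range ι → σ' x = x := by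
    intro x hx
    rcases hr x hx with rfl | rfl
    · exact skip_fixed _ _ (skip_self _ _)
    · exact skip_self _ _
  have hinv : (dartRev H)⁻¹ d = d.symm := by
    rw [Perm.inv_eq_iff_eq, dartRev_apply, SimpleGraph.Dart.symm_symm]
  have fα : ∀ x, x ∉ Set.range ι → α' x = x := by
    intro x hx
    rcases hr x hx with rfl | rfl
    · exact skip_self _ _
    · rw [hα', skip, hinv, Perm.mul_apply, swap_apply_right, dartRev_apply]
  obtain ⟨σG, hσG⟩ := perm_restrict hι σ' fσ
  have hαG : ∀ x, ι (dartRev G x) = α' (ι x) := by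
    intro x
    rw [hα', skip, hinv, Perm.mul_apply, swap_apply_of_ne_of_ne (hr2 x).1 (hr2 x).2]
    rfl
  have tail : ∀ x, (σ' x).fst = x.fst :=
    skip_inv (fun x : H.Dart => x.fst) _ (skip_inv (fun x : H.Dart => x.fst) _ R.tail_fixed)
  let RG : RotationSystem G :=
    { σ := σG
      tail_fixed := by
        intro x
        apply hf
        have : (ι (σG x)).fst = (ι x).fst := by rw [hσG, tail]
        exact this
      vertex_cycles := by
        intro x y hxy
        have h1 : cyc R.σ (ι x) (ι y) := R.vertex_cycles _ _ (congrArg f hxy)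
        have h2 : cyc σ' (ι x) (ι y) :=
          cyc_skip (hr2 x).2 (hr2 y).2 (cyc_skip (hr2 x).1 (hr2 y).1 h1)
        rcases cyc_le_ext hι hσG fσ h2 with h | ⟨x', y', hx, hy, h⟩
        · rw [hι h]
        · rwa [hι hx, hι hy] at h }
  have e2 := defect_eq RG
  have n2 := defect_nonneg RG.σ (dartRev G)
  have l1 : defect RG.σ (dartRev G) ≤ defect σ' α' := defect_restrict hι hσG hαG fσ fα
  have l2 : defect σ' α' ≤ defect R.σ (dartRev H) :=
    (defect_skip_right _ _ _).trans ((defect_skip_left _ _ _).trans (defect_skip_left _ _ _))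
  have i0 : Nat.card (Iso0 G) = 0 := by
    have : IsEmpty (Iso0 G) := ⟨fun x => by
      obtain ⟨j, hj⟩ := hiso x.1
      exact x.2 j hj⟩
    exact Nat.card_of_isEmpty
  refine ⟨RG, ?_⟩
  unfold RotationSystem.IsPlanarEmbedding
  have n1' : defect R.σ (dartRev H) ≤ 0 := by rw [e1]; omega
  have : defect RG.σ (dartRev G) = 0 := by
    refine le_antisymm ?_ ?_
    · exact l1.trans (l2.trans n1')
    · convert n2
  rw [e2] at this
  omega

end PM
namespace PM

theorem vdeg_le_of_inj {V W : Type*} [Finite W] {G : SimpleGraph V} {K : SimpleGraph W} (f : V → W)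
    (hf : Function.Injective f) (h : ∀ a b, G.Adj a b → K.Adj (f a) (f b)) (i : V) :
    vdeg G i ≤ vdeg K (f i) := by
  refine Nat.card_le_card_of_injective
    (fun x : G.neighborSet i => (⟨f x.1, h _ _ x.2⟩ : K.neighborSet (f i))) ?_
  intro x y hxy
  exact Subtype.ext (hf (congrArg Subtype.val hxy))

theorem edges_map_set {V W : Type*} {G : SimpleGraph V} {K : SimpleGraph W} (φ : G →g K)
    {u v : V} (c : G.Walk u v) :
    {e | e ∈ (c.map φ).edges} = Sym2.map φ '' {e | e ∈ c.edges} := by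
  ext e; simp [SimpleGraph.Walk.edges_map]

theorem del_colorable {V : Type*} [Fintype V] {H : SimpleGraph V} (hmin : MinimalCounterexample H)
    {p q : V} (hpq : H.Adj p q) (h6 : ∃ w, vdeg (H.deleteEdges {s(p, q)}) w = 6) :
    TotallyColorable (H.deleteEdges {s(p, q)}) 7 := by
  classical
  obtain ⟨⟨hplan, ⟨hmax, -⟩, hdia, hhouse, hgood⟩, -, hm⟩ := hmin
  set H' := H.deleteEdges {s(p, q)} with hH'
  have hadj' : ∀ a b, H'.Adj a b ↔ H.Adj a b ∧ s(a, b) ≠ s(p, q) := by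
    intro a b; simp [hH', SimpleGraph.deleteEdges_adj]
  let S := {a : V // ∃ b, H'.Adj a b}
  let e : S ≃ Fin (Fintype.card S) := Fintype.equivFin S
  let f : Fin (Fintype.card S) → V := fun i => (e.symm i).1
  have hf : Function.Injective f := fun i j h => e.symm.injective (Subtype.ext h)
  have hcov : ∀ a b, H'.Adj a b → ∃ i, f i = a := by
    intro a b hab
    exact ⟨e ⟨a, b, hab⟩, by simp [f]⟩
  let G : SimpleGraph (Fin (Fintype.card S)) := H'.comap f
  have hGa : ∀ i j, G.Adj i j ↔ H'.Adj (f i) (f j) := fun i j => Iff.rfl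
  have hGH : ∀ i j, G.Adj i j → H.Adj (f i) (f j) := fun i j h => ((hadj' _ _).1 h).1
  let φ : G →g H := ⟨f, fun h => hGH _ _ h⟩
  have hφ : Function.Injective φ := hf
  have hplanG : IsPlanar G := by
    refine planar_delete hplan hpq G f hf (fun i j => ?_) ?_ ?_
    · rw [hGa, hadj']
    · intro a b h1 h2
      exact hcov a b ((hadj' a b).2 ⟨h1, h2⟩)
    · intro i
      obtain ⟨b, hb⟩ := (e.symm i).2
      obtain ⟨j, hj⟩ := hcov b _ hb.symm
      refine ⟨j, ?_⟩
      rw [hGa, hj]; exact hb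
  have hdeg : ∀ i, vdeg G i ≤ vdeg H (f i) := vdeg_le_of_inj f hf hGH
  obtain ⟨w, hw⟩ := h6
  obtain ⟨i0, hi0⟩ : ∃ i, f i = w := by
    by_contra hc
    have : IsEmpty (H'.neighborSet w) := ⟨fun x => hc (hcov w x.1 x.2)⟩
    have : vdeg H' w = 0 := Nat.card_of_isEmpty
    omega
  have hdeg0 : vdeg H' w ≤ vdeg G i0 := by
    refine Nat.card_le_card_of_surjective
      (fun x : G.neighborSet i0 => (⟨f x.1, by rw [← hi0]; exact x.2⟩ : H'.neighborSet w)) ?_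
    rintro ⟨b, hb⟩
    have hb : H'.Adj w b := hb
    obtain ⟨j, hj⟩ := hcov b _ hb.symm
    refine ⟨⟨j, ?_⟩, Subtype.ext hj⟩
    change H'.Adj (f i0) (f j)
    rw [hj, hi0]; exact hb
  have hgoodG : GoodGraph G := by
    refine ⟨hplanG, ⟨fun i => (hdeg i).trans (hmax _), i0, ?_⟩, ?_, ?_, ?_⟩
    · exact le_antisymm ((hdeg i0).trans (hmax _)) (hw ▸ hdeg0)
    · rintro ⟨g, hg, hg2⟩
      exact hdia ⟨f ∘ g, hf.comp hg, fun _ _ h => hGH _ _ (hg2 h)⟩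
    · rintro ⟨g, hg, hg2⟩
      exact hhouse ⟨f ∘ g, hf.comp hg, fun _ _ h => hGH _ _ (hg2 h)⟩
    · intro i hi
      have hi' : vdeg H (f i) = 6 := le_antisymm (hmax _) (hi ▸ hdeg i)
      have hne : ∀ (c₁ c₂ : G.Walk i i), {e | e ∈ c₁.edges} ≠ {e | e ∈ c₂.edges} →
          {e | e ∈ (c₁.map φ).edges} ≠ {e | e ∈ (c₂.map φ).edges} := by
        intro c₁ c₂ h k
        rw [edges_map_set, edges_map_set] at k
        exact h ((Sym2.map.injective hφ).image_injective k)
      refine (hgood (f i) hi').imp ?_ ?_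
      · rintro h ⟨c₁, c₂, a1, a2, a3, a4, a5, e, a6, a7⟩
        refine h ⟨c₁.map φ, c₂.map φ, a1.map hφ, a2.map hφ, by simpa using a3, by simpa using a4,
          hne _ _ a5, Sym2.map φ e, ?_, ?_⟩
        · rw [SimpleGraph.Walk.edges_map]; exact List.mem_map_of_mem a6
        · rw [SimpleGraph.Walk.edges_map]; exact List.mem_map_of_mem a7
      · rintro h p q l hpql ⟨c₁, c₂, c₃, a1, a2, a3, a4, a5, a6, a7, a8, a9⟩
        exact h p q l hpql ⟨c₁.map φ, c₂.map φ, c₃.map φ, a1.map hφ, a2.map hφ, a3.map hφ,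
          by simpa using a4, by simpa using a5, by simpa using a6, hne _ _ a7, hne _ _ a8,
          hne _ _ a9⟩
  have hcardE : Nat.card G.edgeSet < Nat.card H.edgeSet := by
    have h1 : Nat.card G.edgeSet ≤ Nat.card H'.edgeSet := by
      refine Nat.card_le_card_of_injective (fun x : G.edgeSet =>
        (⟨Sym2.map f x.1, ?_⟩ : H'.edgeSet)) ?_
      · obtain ⟨x, hx⟩ := x
        induction x using Sym2.ind with
        | _ a b => exact hx
      · intro x y h
        exact Subtype.ext (Sym2.map.injective hf (congrArg Subtype.val h))
    refine lt_of_le_of_lt h1 ?_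
    change Set.ncard _ < Set.ncard _
    apply Set.ncard_lt_ncard _ (Set.toFinite _)
    rw [hH', SimpleGraph.edgeSet_deleteEdges]
    refine ⟨Set.sdiff_subset, fun hh => ?_⟩
    exact (hh (show s(p, q) ∈ H.edgeSet from hpq)).2 rfl
  have hcardV : Fintype.card S ≤ Fintype.card V := Fintype.card_subtype_le _
  have hcol : TotallyColorable G 7 := by
    by_contra hc
    have := hm _ G hgoodG hc
    omega
  obtain ⟨cv, ce, c1, c2, c3⟩ := hcol
  have : Nonempty (Fin (Fintype.card S)) := ⟨i0⟩
  let g := Function.invFun f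
  have hg : ∀ a b, H'.Adj a b → f (g a) = a := fun a b h => Function.invFun_eq (hcov a b h)
  have hgG : ∀ a b, H'.Adj a b → G.Adj (g a) (g b) := by
    intro a b h
    rw [hGa, hg a b h, hg b a h.symm]; exact h
  have hfg : ∀ e ∈ H'.edgeSet, Sym2.map f (Sym2.map g e) = e := by
    intro e he
    induction e using Sym2.ind with
    | _ a b => simp [hg a b he, hg b a (SimpleGraph.Adj.symm he)]
  refine ⟨fun a => cv (g a), fun e => ce (Sym2.map g e), fun a b h => c1 (hgG a b h), ?_,
    fun a b h => c3 (hgG a b h)⟩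
  rintro e₁ h1 e₂ h2 hne ⟨x, hx1, hx2⟩
  refine c2 _ ?_ _ ?_ ?_ ⟨g x, Sym2.mem_map.2 ⟨x, hx1, rfl⟩, Sym2.mem_map.2 ⟨x, hx2, rfl⟩⟩
  · induction e₁ using Sym2.ind with
    | _ a b => exact hgG a b h1
  · induction e₂ using Sym2.ind with
    | _ a b => exact hgG a b h2
  · intro k
    apply hne
    rw [← hfg e₁ h1, ← hfg e₂ h2, k]

end PM
namespace PM

structure PC {V : Type*} (K : SimpleGraph V) (S : Set V) (cv : V → Fin 7) (ce : Sym2 V → Fin 7) :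
    Prop where
  vv : ∀ a b, K.Adj a b → a ∉ S → b ∉ S → cv a ≠ cv b
  ee : ∀ a b c, K.Adj a b → K.Adj a c → b ≠ c → ce s(a, b) ≠ ce s(a, c)
  ev : ∀ a b, K.Adj a b → a ∉ S → ce s(a, b) ≠ cv a

theorem PC.mono {V : Type*} {K L : SimpleGraph V} {S T : Set V} {cv : V → Fin 7}
    {ce : Sym2 V → Fin 7} (h : PC K S cv ce) (hL : ∀ a b, L.Adj a b → K.Adj a b) (hS : S ⊆ T) :
    PC L T cv ce :=
  ⟨fun a b h1 h2 h3 => h.vv a b (hL _ _ h1) (fun k => h2 (hS k)) (fun k => h3 (hS k)),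
   fun a b c h1 h2 => h.ee a b c (hL _ _ h1) (hL _ _ h2),
   fun a b h1 h2 => h.ev a b (hL _ _ h1) (fun k => h2 (hS k))⟩

theorem pc_of_total {V : Type*} {K : SimpleGraph V} (h : TotallyColorable K 7) :
    ∃ cv ce, PC K ∅ cv ce := by
  obtain ⟨cv, ce, h1, h2, h3⟩ := h
  refine ⟨cv, ce, fun a b h _ _ => h1 h, fun a b c hb hc hbc => ?_, fun a b h _ => h3 h⟩
  refine h2 _ hb _ hc ?_ ⟨a, by simp, by simp⟩
  intro k
  exact hbc (Sym2.congr_right.1 k)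

theorem total_of_pc {V : Type*} {K : SimpleGraph V} {cv : V → Fin 7} {ce : Sym2 V → Fin 7}
    (h : PC K ∅ cv ce) : TotallyColorable K 7 := by
  refine ⟨cv, ce, fun a b k => h.vv a b k (by simp) (by simp), ?_,
    fun a b k => h.ev a b k (by simp)⟩
  rintro e₁ h1 e₂ h2 hne ⟨x, hx1, hx2⟩
  obtain ⟨b, rfl⟩ := hx1
  obtain ⟨c, rfl⟩ := hx2
  exact h.ee x b c h1 h2 (fun k => hne (by rw [k]))

theorem free_color (T : Finset (Fin 7)) (h : T.card < 7) : ∃ c, c ∉ T := by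
  by_contra hc
  push Not at hc
  have : T = Finset.univ := Finset.eq_univ_iff_forall.2 hc
  rw [this] at h
  simp at h

open Classical in
theorem pc_ext {V : Type*} {K L : SimpleGraph V} {S : Set V} {cv : V → Fin 7}
    {ce : Sym2 V → Fin 7} (h : PC K S cv ce) {p q : V} {c : Fin 7}
    (hL : ∀ a b, L.Adj a b → K.Adj a b ∨ s(a, b) = s(p, q))
    (hv : p ∉ S → q ∉ S → cv p ≠ cv q)
    (hp : ∀ w, K.Adj p w → w ≠ q → ce s(p, w) ≠ c)
    (hq : ∀ w, K.Adj q w → w ≠ p → ce s(q, w) ≠ c)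
    (hcp : p ∉ S → cv p ≠ c) (hcq : q ∉ S → cv q ≠ c) :
    PC L S cv (Function.update ce s(p, q) c) := by
  refine ⟨?_, ?_, ?_⟩
  · intro a b hab ha hb
    rcases hL a b hab with k | k
    · exact h.vv a b k ha hb
    · rcases Sym2.eq_iff.1 k with ⟨rfl, rfl⟩ | ⟨rfl, rfl⟩
      · exact hv ha hb
      · exact (hv hb ha).symm
  · intro a b d hab had hbd
    by_cases k1 : s(a, b) = s(p, q) <;> by_cases k2 : s(a, d) = s(p, q)
    · exact absurd (Sym2.congr_right.1 (k1.trans k2.symm)) hbd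
    · have had := (hL a d had).resolve_right k2
      rw [k1, Function.update_self, Function.update_of_ne k2]
      rcases Sym2.eq_iff.1 k1 with ⟨rfl, rfl⟩ | ⟨rfl, rfl⟩
      · exact (hp d had hbd.symm).symm
      · exact (hq d had hbd.symm).symm
    · have hab := (hL a b hab).resolve_right k1
      rw [k2, Function.update_self, Function.update_of_ne k1]
      rcases Sym2.eq_iff.1 k2 with ⟨rfl, rfl⟩ | ⟨rfl, rfl⟩
      · exact hp b hab hbd
      · exact hq b hab hbd
    · rw [Function.update_of_ne k1, Function.update_of_ne k2]
      exact h.ee a b d ((hL a b hab).resolve_right k1) ((hL a d had).resolve_right k2) hbd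
  · intro a b hab ha
    by_cases k1 : s(a, b) = s(p, q)
    · rw [k1, Function.update_self]
      rcases Sym2.eq_iff.1 k1 with ⟨rfl, rfl⟩ | ⟨rfl, rfl⟩
      · exact (hcp ha).symm
      · exact (hcq ha).symm
    · rw [Function.update_of_ne k1]
      exact h.ev a b ((hL a b hab).resolve_right k1) ha

open Classical in
theorem pc_vertex {V : Type*} {H : SimpleGraph V} {S : Set V} {x : V} {cv : V → Fin 7}
    {ce : Sym2 V → Fin 7} (h : PC H (insert x S) cv ce) {a b : V}
    (hab : ∀ w, H.Adj x w → w = a ∨ w = b) : ∃ cv', PC H S cv' ce := by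
  obtain ⟨c, hc⟩ := free_color {cv a, cv b, ce s(x, a), ce s(x, b)}
    (lt_of_le_of_lt Finset.card_le_four (by norm_num))
  simp only [Finset.mem_insert, Finset.mem_singleton, not_or] at hc
  obtain ⟨c1, c2, c3, c4⟩ := hc
  have key : ∀ w, H.Adj x w → cv w ≠ c ∧ ce s(x, w) ≠ c := by
    intro w hw
    rcases hab w hw with rfl | rfl
    · exact ⟨Ne.symm c1, Ne.symm c3⟩
    · exact ⟨Ne.symm c2, Ne.symm c4⟩
  have hS : ∀ w, w ≠ x → w ∉ S → w ∉ insert x S := by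
    intro w h1 h2 h3
    rcases h3 with h3 | h3
    · exact h1 h3
    · exact h2 h3
  refine ⟨Function.update cv x c, ?_, h.ee, ?_⟩
  · intro u w huw hu hw
    by_cases k1 : u = x
    · subst k1
      rw [Function.update_self, Function.update_of_ne huw.ne']
      exact (key w huw).1.symm
    · by_cases k2 : w = x
      · subst k2
        rw [Function.update_self, Function.update_of_ne k1]
        exact (key u huw.symm).1
      · rw [Function.update_of_ne k1, Function.update_of_ne k2]
        exact h.vv u w huw (hS u k1 hu) (hS w k2 hw)
  · intro u w huw hu
    by_cases k1 : u = x
    · subst k1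
      rw [Function.update_self]
      exact (key w huw).2
    · rw [Function.update_of_ne k1]
      exact h.ev u w huw (hS u k1 hu)

theorem deg_two {V : Type*} [Finite V] {H : SimpleGraph V} {x v : V} (h : vdeg H x = 2)
    (hv : H.Adj x v) : ∃ u, H.Adj x u ∧ u ≠ v ∧ ∀ w, H.Adj x w → w = v ∨ w = u := by
  obtain ⟨a, b, hab, hs⟩ := Set.ncard_eq_two.1 (show (H.neighborSet x).ncard = 2 from h)
  have ha : ∀ w, H.Adj x w ↔ w = a ∨ w = b := by
    intro w
    have : w ∈ H.neighborSet x ↔ w ∈ ({a, b} : Set V) := by rw [hs]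
    simpa using this
  rcases (ha v).1 hv with rfl | rfl
  · exact ⟨b, (ha b).2 (Or.inr rfl), hab.symm, fun w hw => (ha w).1 hw⟩
  · exact ⟨a, (ha a).2 (Or.inl rfl), hab, fun w hw => ((ha w).1 hw).symm⟩

/-- a color missing at `p` when the edge `pq` is uncolored -/
theorem missing {V : Type*} [Finite V] {H : SimpleGraph V} {p q : V} (hpq : H.Adj p q) {k : ℕ}
    (hd : vdeg H p ≤ k + 1) (cv : V → Fin 7) (ce : Sym2 V → Fin 7) (T : Finset (Fin 7))
    (hT : T.card + k < 6) :
    ∃ c, c ∉ T ∧ cv p ≠ c ∧ ∀ w, H.Adj p w → w ≠ q → ce s(p, w) ≠ c := by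
  classical
  have := Fintype.ofFinite V
  have hN : (H.neighborSet p).ncard ≤ k + 1 := hd
  let N : Finset V := (H.neighborSet p).toFinset.erase q
  have hq : q ∈ (H.neighborSet p).toFinset := by simpa using hpq
  have hNc : N.card ≤ k := by
    rw [Finset.card_erase_of_mem hq, ← Set.ncard_eq_toFinset_card']
    omega
  have h1 : (N.image (fun w => ce s(p, w))).card ≤ k := Finset.card_image_le.trans hNc
  obtain ⟨c, hc⟩ := free_color (insert (cv p) (T ∪ N.image (fun w => ce s(p, w)))) (by
    refine lt_of_le_of_lt (Finset.card_insert_le _ _) ?_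
    have := Finset.card_union_le T (N.image (fun w => ce s(p, w)))
    omega)
  simp only [Finset.mem_insert, Finset.mem_union, not_or] at hc
  refine ⟨c, hc.2.1, Ne.symm hc.1, fun w hw hwq k => hc.2.2 ?_⟩
  rw [Finset.mem_image]
  exact ⟨w, by simp [N, hwq, hw], k⟩

/-- finishing: color `v y` with `m` and `v x` with `k`. -/
theorem finish2 {V : Type*} {H K : SimpleGraph V} {S : Set V} {cv : V → Fin 7}
    {ce : Sym2 V → Fin 7} (h : PC K S cv ce) {v x y : V} (hxS : x ∈ S) (hyS : y ∈ S)
    (hxv : v ≠ x) (hxy : x ≠ y)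
    (hH : ∀ a b, H.Adj a b → K.Adj a b ∨ s(a, b) = s(v, y) ∨ s(a, b) = s(v, x))
    {m k : Fin 7} (hmk : m ≠ k) (hvm : cv v ≠ m) (hvk : cv v ≠ k)
    (hm : ∀ w, K.Adj v w → ce s(v, w) ≠ m) (hk : ∀ w, K.Adj v w → ce s(v, w) ≠ k)
    (hy : ∀ w, K.Adj y w → ce s(y, w) ≠ m) (hx : ∀ w, K.Adj x w → ce s(x, w) ≠ k) :
    ∃ ce', PC H S cv ce' := by
  classical
  let L : SimpleGraph V := K ⊔ SimpleGraph.fromEdgeSet {s(v, y)}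
  have hL : ∀ a b, L.Adj a b → K.Adj a b ∨ s(a, b) = s(v, y) := by
    intro a b hab
    simp only [L, SimpleGraph.sup_adj, SimpleGraph.fromEdgeSet_adj, Set.mem_singleton_iff] at hab
    tauto
  have hL2 : ∀ a b, H.Adj a b → L.Adj a b ∨ s(a, b) = s(v, x) := by
    intro a b hab
    have := hab.ne
    have := hH a b hab
    simp only [L, SimpleGraph.sup_adj, SimpleGraph.fromEdgeSet_adj, Set.mem_singleton_iff]
    tauto
  have h1 := pc_ext h (L := L) (p := v) (q := y) (c := m) hL (fun _ k => absurd hyS k)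
    (fun w hw _ => hm w hw) (fun w hw _ => hy w hw) (fun _ => hvm) (fun k => absurd hyS k)
  refine ⟨_, pc_ext h1 (L := H) (p := v) (q := x) (c := k) hL2 (fun _ k => absurd hxS k)
    ?_ ?_ (fun _ => hvk) (fun k => absurd hxS k)⟩
  · intro w hw _
    by_cases e : s(v, w) = s(v, y)
    · rw [e, Function.update_self]; exact hmk
    · rw [Function.update_of_ne e]; exact hk w ((hL _ _ hw).resolve_right e)
  · intro w hw _
    have e : s(x, w) ≠ s(v, y) := by
      intro e
      rcases Sym2.eq_iff.1 e with ⟨e, _⟩ | ⟨e, _⟩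
      · exact hxv e.symm
      · exact hxy e
    rw [Function.update_of_ne e]; exact hx w ((hL _ _ hw).resolve_right e)

end PM
namespace PM

theorem del_adj {V : Type*} {H : SimpleGraph V} {T : Set (Sym2 V)} {a b : V} :
    (H.deleteEdges T).Adj a b ↔ H.Adj a b ∧ s(a, b) ∉ T := SimpleGraph.deleteEdges_adj

/-- the common setting of the recoloring argument -/
structure Cfg {V : Type*} (H : SimpleGraph V) (S : Set V) (v x₁ x₂ x₃ u₁ u₂ u₃ : V)
    (cv : V → Fin 7) (ce : Sym2 V → Fin 7) (m : Fin 7) : Prop where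
  pc : PC (H.deleteEdges {s(v, x₃)}) S cv ce
  vS : v ∉ S
  s1 : x₁ ∈ S
  s2 : x₂ ∈ S
  s3 : x₃ ∈ S
  x12 : x₁ ≠ x₂
  x13 : x₁ ≠ x₃
  x23 : x₂ ≠ x₃
  a1 : H.Adj v x₁
  a2 : H.Adj v x₂
  a3 : H.Adj v x₃
  b1 : H.Adj x₁ u₁
  b2 : H.Adj x₂ u₂
  b3 : H.Adj x₃ u₃
  c1 : u₁ ≠ v
  c2 : u₂ ≠ v
  c3 : u₃ ≠ v
  uu : H.Adj u₁ u₂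
  n1 : ∀ w, H.Adj x₁ w → w = v ∨ w = u₁
  n2 : ∀ w, H.Adj x₂ w → w = v ∨ w = u₂
  n3 : ∀ w, H.Adj x₃ w → w = v ∨ w = u₃
  vm : cv v ≠ m
  mv : ∀ w, H.Adj v w → w ≠ x₃ → ce s(v, w) ≠ m
  m3 : ce s(x₃, u₃) = m

variable {V : Type*} {H : SimpleGraph V} {S : Set V} {v x₁ x₂ x₃ u₁ u₂ u₃ : V}
    {cv : V → Fin 7} {ce : Sym2 V → Fin 7} {m : Fin 7}

theorem Cfg.symm (h : Cfg H S v x₁ x₂ x₃ u₁ u₂ u₃ cv ce m) :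
    Cfg H S v x₂ x₁ x₃ u₂ u₁ u₃ cv ce m :=
  ⟨h.pc, h.vS, h.s2, h.s1, h.s3, h.x12.symm, h.x23, h.x13, h.a2, h.a1, h.a3, h.b2, h.b1, h.b3,
   h.c2, h.c1, h.c3, h.uu.symm, h.n2, h.n1, h.n3, h.vm, h.mv, h.m3⟩

/-- the graph `H - v x₃` -/
theorem Cfg.ee' (h : Cfg H S v x₁ x₂ x₃ u₁ u₂ u₃ cv ce m) {a b c : V} (hab : H.Adj a b)
    (hac : H.Adj a c) (h1 : s(a, b) ≠ s(v, x₃)) (h2 : s(a, c) ≠ s(v, x₃)) (hbc : b ≠ c) :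
    ce s(a, b) ≠ ce s(a, c) :=
  h.pc.ee a b c (del_adj.2 ⟨hab, h1⟩) (del_adj.2 ⟨hac, h2⟩) hbc

theorem Cfg.ev' (h : Cfg H S v x₁ x₂ x₃ u₁ u₂ u₃ cv ce m) {a b : V} (hab : H.Adj a b)
    (h1 : s(a, b) ≠ s(v, x₃)) (ha : a ∉ S) : ce s(a, b) ≠ cv a :=
  h.pc.ev a b (del_adj.2 ⟨hab, h1⟩) ha

/-- final step: from a coloring `ce'` of `H - v x₃ - v x₁` which agrees with `ce` at `v`, `x₃` -/
theorem Cfg.final (h : Cfg H S v x₁ x₂ x₃ u₁ u₂ u₃ cv ce m) {ce' : Sym2 V → Fin 7}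
    (pc : PC (H.deleteEdges {s(v, x₃), s(v, x₁)}) S cv ce')
    (hv : ∀ w, H.Adj v w → w ≠ x₃ → w ≠ x₁ → ce' s(v, w) = ce s(v, w))
    (h3 : ce' s(x₃, u₃) = m) (h1 : ce' s(x₁, u₁) ≠ m) :
    ∃ ce'', PC H S cv ce'' := by
  have v3 := h.a3.ne
  have v1 := h.a1.ne
  have hx13 := h.x13
  have e1 : s(v, x₁) ≠ s(v, x₃) := fun k => hx13 (Sym2.congr_right.1 k)
  have hmk : m ≠ ce s(v, x₁) := (h.mv x₁ h.a1 hx13).symm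
  have hv' : ∀ w, (H.deleteEdges {s(v, x₃), s(v, x₁)}).Adj v w →
      H.Adj v w ∧ w ≠ x₃ ∧ w ≠ x₁ := by
    intro w hw
    obtain ⟨k1, k2⟩ := del_adj.1 hw
    refine ⟨k1, ?_, ?_⟩ <;> rintro rfl <;> exact k2 (by simp)
  refine finish2 pc (v := v) (x := x₃) (y := x₁) (m := m) (k := ce s(v, x₁)) h.s3 h.s1 v3
    hx13.symm ?_ hmk h.vm (h.ev' h.a1 e1 h.vS).symm ?_ ?_ ?_ ?_
  · intro a b hab
    rw [del_adj, Set.mem_insert_iff, Set.mem_singleton_iff]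
    tauto
  · intro w hw
    obtain ⟨k1, k2, k3⟩ := hv' w hw
    rw [hv w k1 k2 k3]
    exact h.mv w k1 k2
  · intro w hw
    obtain ⟨k1, k2, k3⟩ := hv' w hw
    rw [hv w k1 k2 k3]
    exact h.ee' k1 h.a1 (fun k => k2 (Sym2.congr_right.1 k)) e1 k3
  · intro w hw
    obtain ⟨k1, k2⟩ := del_adj.1 hw
    rcases h.n1 w k1 with rfl | rfl
    · exact absurd (by simp [Sym2.eq_swap]) k2
    · exact h1
  · intro w hw
    obtain ⟨k1, k2⟩ := del_adj.1 hw
    rcases h.n3 w k1 with rfl | rfl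
    · exact absurd (by simp [Sym2.eq_swap]) k2
    · rw [h3]; exact hmk

theorem Cfg.case1 (h : Cfg H S v x₁ x₂ x₃ u₁ u₂ u₃ cv ce m) (h1 : ce s(x₁, u₁) ≠ m) :
    ∃ ce'', PC H S cv ce'' := by
  refine h.final (ce' := ce) (h.pc.mono ?_ subset_rfl) (fun _ _ _ _ => rfl) h.m3 h1
  intro a b hab
  rw [del_adj] at hab ⊢
  exact ⟨hab.1, fun k => hab.2 (Or.inl k)⟩

open Classical in
theorem Cfg.tri (h : Cfg H S v x₁ x₂ x₃ u₁ u₂ u₃ cv ce m) (h1 : u₁ = x₂) :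
    ∃ ce'', PC H S cv ce'' := by
  have v3 := h.a3.ne
  have v1 := h.a1.ne
  have v2 := h.a2.ne
  have x12 := h.x12
  have x13 := h.x13
  have x23 := h.x23
  subst h1
  have h2 : x₁ = u₂ := (h.n2 x₁ h.b1.symm).resolve_left v1.symm
  subst h2
  obtain ⟨c, hc⟩ := free_color {m, ce s(u₁, v)} (lt_of_le_of_lt Finset.card_le_two (by norm_num))
  simp only [Finset.mem_insert, Finset.mem_singleton, not_or] at hc
  have pcK : PC (H.deleteEdges {s(v, x₃), s(v, x₁)}) S cv ce := by
    refine h.pc.mono ?_ subset_rfl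
    intro a b hab
    rw [del_adj] at hab ⊢
    exact ⟨hab.1, fun k => hab.2 (Or.inl k)⟩
  have pc1 := pc_ext pcK (L := H.deleteEdges {s(v, x₃), s(v, x₁)}) (p := x₁) (q := u₁) (c := c)
    (fun a b h => Or.inl h) (fun k => absurd h.s1 k) ?_ ?_ (fun k => absurd h.s1 k)
    (fun k => absurd h.s2 k)
  · refine h.final pc1 ?_ ?_ ?_
    · intro w _ _ _
      rw [Function.update_of_ne]
      simp [v1, v2]
    · rw [Function.update_of_ne, h.m3]
      simp [x13.symm, x23.symm]
    · rw [Function.update_self]; exact hc.1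
  · intro w hw hwu
    obtain ⟨k1, k2⟩ := del_adj.1 hw
    rcases h.n1 w k1 with rfl | rfl
    · exact absurd (by simp [Sym2.eq_swap]) k2
    · exact absurd rfl hwu
  · intro w hw hwu
    obtain ⟨k1, k2⟩ := del_adj.1 hw
    rcases h.n2 w k1 with rfl | rfl
    · exact Ne.symm hc.2
    · exact absurd rfl hwu

open Classical in
theorem Cfg.core (h : Cfg H S v x₁ x₂ x₃ u₁ u₂ u₃ cv ce m) (h12 : u₁ ≠ x₂) (h21 : u₂ ≠ x₁)
    (m1 : ce s(x₁, u₁) = m) (m2 : ce s(x₂, u₂) = m) (hc : ce s(u₁, u₂) ≠ ce s(v, x₂)) :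
    ∃ ce'', PC H S cv ce'' := by
  have v3 := h.a3.ne
  have v1 := h.a1.ne
  have v2 := h.a2.ne
  have x12 := h.x12
  have x13 := h.x13
  have x23 := h.x23
  have c1 := h.c1
  have c2 := h.c2
  have uu := h.uu.ne
  have xu1 := h.b1.ne
  have xu2 := h.b2.ne
  have u13 : u₁ ≠ x₃ := by
    rintro rfl
    have k1 := (h.n3 _ h.b1.symm).resolve_left v1.symm
    have k2 := (h.n3 _ h.uu).resolve_left c2
    exact h21 (k2.trans k1.symm)
  have u23 : u₂ ≠ x₃ := by
    rintro rfl
    have k1 := (h.n3 _ h.b2.symm).resolve_left v2.symm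
    have k2 := (h.n3 _ h.uu.symm).resolve_left c1
    exact h12 (k2.trans k1.symm)
  set c := ce s(u₁, u₂) with hcdef
  have m1' : ce s(u₁, x₁) = m := by rw [Sym2.eq_swap]; exact m1
  have m2' : ce s(u₂, x₂) = m := by rw [Sym2.eq_swap]; exact m2
  have hc' : ce s(u₂, u₁) = c := by rw [Sym2.eq_swap]
  have g1 : ∀ w, s(u₁, w) ≠ s(v, x₃) := by intro w; simp [c1, u13]
  have g2 : ∀ w, s(u₂, w) ≠ s(v, x₃) := by intro w; simp [c2, u23]
  have hmc : m ≠ c := by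
    rw [← m1']
    exact h.ee' h.b1.symm h.uu (g1 _) (g1 _) h21.symm
  -- step 0
  have p0 : PC (H.deleteEdges {s(v, x₃), s(v, x₁), s(x₁, u₁), s(x₂, u₂), s(u₁, u₂)}) S cv ce := by
    refine h.pc.mono ?_ subset_rfl
    intro a b hab
    rw [del_adj] at hab ⊢
    exact ⟨hab.1, fun k => hab.2 (Or.inl k)⟩
  have p1 := pc_ext p0 (L := H.deleteEdges {s(v, x₃), s(v, x₁), s(x₁, u₁), s(x₂, u₂)})
    (p := u₁) (q := u₂) (c := m) (by
      intro a b hab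
      simp only [del_adj, Set.mem_insert_iff, Set.mem_singleton_iff] at hab ⊢
      tauto)
    (h.pc.vv u₁ u₂ (del_adj.2 ⟨h.uu, g1 _⟩))
    (by
      intro w hw _
      obtain ⟨k1, k2⟩ := del_adj.1 hw
      rw [← m1']
      refine h.ee' k1 h.b1.symm (g1 _) (g1 _) ?_
      rintro rfl
      exact k2 (by simp [Sym2.eq_swap]))
    (by
      intro w hw _
      obtain ⟨k1, k2⟩ := del_adj.1 hw
      rw [← m2']
      refine h.ee' k1 h.b2.symm (g2 _) (g2 _) ?_
      rintro rfl
      exact k2 (by simp [Sym2.eq_swap]))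
    (fun k => by rw [← m1']; exact (h.ev' h.b1.symm (g1 _) k).symm)
    (fun k => by rw [← m2']; exact (h.ev' h.b2.symm (g2 _) k).symm)
  have p2 := pc_ext p1 (L := H.deleteEdges {s(v, x₃), s(v, x₁), s(x₂, u₂)})
    (p := x₁) (q := u₁) (c := c) (by
      intro a b hab
      simp only [del_adj, Set.mem_insert_iff, Set.mem_singleton_iff] at hab ⊢
      tauto)
    (fun k => absurd h.s1 k)
    (by
      intro w hw hwu
      obtain ⟨k1, k2⟩ := del_adj.1 hw
      rcases h.n1 w k1 with rfl | rfl
      · exact absurd (by simp [Sym2.eq_swap]) k2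
      · exact absurd rfl hwu)
    (by
      intro w hw hwx
      obtain ⟨k1, k2⟩ := del_adj.1 hw
      by_cases hw2 : w = u₂
      · rw [hw2, Function.update_self]; exact hmc
      · rw [Function.update_of_ne (fun k => hw2 (Sym2.congr_right.1 k))]
        exact h.ee' k1 h.uu (g1 _) (g1 _) hw2)
    (fun k => absurd h.s1 k)
    (fun k => (h.ev' h.uu (g1 _) k).symm)
  have p3 := pc_ext p2 (L := H.deleteEdges {s(v, x₃), s(v, x₁)})
    (p := x₂) (q := u₂) (c := c) (by
      intro a b hab
      simp only [del_adj, Set.mem_insert_iff, Set.mem_singleton_iff] at hab ⊢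
      tauto)
    (fun k => absurd h.s2 k)
    (by
      intro w hw hwu
      obtain ⟨k1, k2⟩ := del_adj.1 hw
      rcases h.n2 w k1 with rfl | rfl
      · rw [Function.update_of_ne (by simp [x12.symm, h12.symm]),
          Function.update_of_ne (by simp [h12.symm, xu2]), Sym2.eq_swap]
        exact hc.symm
      · exact absurd rfl hwu)
    (by
      intro w hw hwx
      obtain ⟨k1, k2⟩ := del_adj.1 hw
      rw [Function.update_of_ne (by simp [h21, uu.symm])]
      by_cases hw2 : w = u₁
      · rw [hw2, Sym2.eq_swap, Function.update_self]; exact hmc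
      · rw [Function.update_of_ne (by simp [hw2, uu.symm]), ← hc']
        exact h.ee' k1 h.uu.symm (g2 _) (g2 _) hw2)
    (fun k => absurd h.s2 k)
    (fun k => by rw [← hc']; exact (h.ev' h.uu.symm (g2 _) k).symm)
  refine h.final p3 ?_ ?_ ?_
  · intro w _ _ _
    rw [Function.update_of_ne (by simp [v2, c2.symm]), Function.update_of_ne (by simp [v1, c1.symm]),
      Function.update_of_ne (by simp [c1.symm, c2.symm])]
  · rw [Function.update_of_ne (by simp [x23.symm, u23.symm]),
      Function.update_of_ne (by simp [x13.symm, u13.symm]),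
      Function.update_of_ne (by simp [u13.symm, u23.symm]), h.m3]
  · rw [Function.update_of_ne (by simp [x12, h21.symm]), Function.update_self]
    exact hmc.symm

theorem Cfg.done (h : Cfg H S v x₁ x₂ x₃ u₁ u₂ u₃ cv ce m) : ∃ ce'', PC H S cv ce'' := by
  by_cases m1 : ce s(x₁, u₁) = m
  swap
  · exact h.case1 m1
  by_cases m2 : ce s(x₂, u₂) = m
  swap
  · exact h.symm.case1 m2
  by_cases h12 : u₁ = x₂
  · exact h.tri h12
  by_cases h21 : u₂ = x₁
  · exact h.symm.tri h21
  by_cases hc : ce s(u₁, u₂) = ce s(v, x₂)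
  · refine h.symm.core h21 h12 m2 m1 ?_
    rw [Sym2.eq_swap, hc]
    exact h.ee' h.a2 h.a1 (fun k => h.x23 (Sym2.congr_right.1 k))
      (fun k => h.x13 (Sym2.congr_right.1 k)) h.x12.symm
  · exact h.core h12 h21 m1 m2 hc

end PM

/-- **Forbidden configuration (1).** A minimal counterexample has no 6-vertex `v` with
three distinct neighbors `x₁, x₂, x₃` of degree 2 such that the neighbor `u₁` of `x₁`
other than `v` and the neighbor `u₂` of `x₂` other than `v` are adjacent. -/
theorem minimal_counterexample_no_config_one
    {V : Type*} [Fintype V] (H : SimpleGraph V)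
    (hmin : MinimalCounterexample H) :
    ¬ ∃ (v x₁ x₂ x₃ u₁ u₂ : V),
      vdeg H v = 6 ∧
      x₁ ≠ x₂ ∧ x₁ ≠ x₃ ∧ x₂ ≠ x₃ ∧
      H.Adj v x₁ ∧ H.Adj v x₂ ∧ H.Adj v x₃ ∧
      vdeg H x₁ = 2 ∧ vdeg H x₂ = 2 ∧ vdeg H x₃ = 2 ∧
      H.Adj x₁ u₁ ∧ u₁ ≠ v ∧
      H.Adj x₂ u₂ ∧ u₂ ≠ v ∧
      H.Adj u₁ u₂ := by
  rintro ⟨v, x₁, x₂, x₃, u₁, u₂, hv6, x12, x13, x23, a1, a2, a3, d1, d2, d3, b1, c1, b2, c2, uu⟩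
  classical
  obtain ⟨u₁', b1', c1', n1⟩ := PM.deg_two d1 a1.symm
  obtain ⟨u₂', b2', c2', n2⟩ := PM.deg_two d2 a2.symm
  obtain ⟨u₃, b3, c3, n3⟩ := PM.deg_two d3 a3.symm
  obtain rfl : u₁ = u₁' := (n1 u₁ b1).resolve_left c1
  obtain rfl : u₂ = u₂' := (n2 u₂ b2).resolve_left c2
  have hmax := hmin.1.2.1.1
  apply hmin.2.1
  have vertexfix : ∀ {cv : V → Fin 7} {ce : Sym2 V → Fin 7},
      PM.PC H {x₁, x₂, x₃} cv ce → TotallyColorable H 7 := by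
    intro cv ce h
    obtain ⟨cv1, h1⟩ := PM.pc_vertex h n1
    obtain ⟨cv2, h2⟩ := PM.pc_vertex h1 n2
    obtain ⟨cv3, h3⟩ := PM.pc_vertex (S := ∅) (by simpa using h2) n3
    exact PM.total_of_pc h3
  -- degrees after deleting an edge away from a vertex
  have hdeg : ∀ w p q, w ≠ p → w ≠ q → vdeg H w ≤ vdeg (H.deleteEdges {s(p, q)}) w := by
    intro w p q hp hq
    refine Nat.card_le_card_of_injective (fun x : H.neighborSet w =>
      (⟨x.1, PM.del_adj.2 ⟨x.2, by simp [hp, hq]⟩⟩ :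
        (H.deleteEdges {s(p, q)}).neighborSet w)) ?_
    intro x y hxy
    have h0 : x.1 = y.1 :=
      congrArg (fun z : (H.deleteEdges {s(p, q)}).neighborSet w => z.1) hxy
    exact Subtype.ext h0
  have hdeg' : ∀ w p q, vdeg (H.deleteEdges {s(p, q)}) w ≤ vdeg H w := by
    intro w p q
    exact PM.vdeg_le_of_inj (fun x => x) (fun _ _ h => h) (fun a b h => (PM.del_adj.1 h).1) w
  by_cases h6 : vdeg H u₃ = 6
  · obtain ⟨cv, ce, pc⟩ := PM.pc_of_total (PM.del_colorable hmin a3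
      ⟨u₃, le_antisymm ((hdeg' _ _ _).trans (hmax _)) (h6 ▸ hdeg u₃ v x₃ c3 b3.ne')⟩)
    obtain ⟨m, -, hm1, hm2⟩ := PM.missing a3 (k := 5) hv6.le cv ce ∅ (by simp)
    have pcS := pc.mono (L := H.deleteEdges {s(v, x₃)}) (T := {x₁, x₂, x₃}) (fun _ _ h => h)
      (Set.empty_subset _)
    by_cases hm3 : ce s(x₃, u₃) = m
    · obtain ⟨ce'', h⟩ := PM.Cfg.done (H := H) (S := {x₁, x₂, x₃})
        ⟨pcS, by simp [a1.ne, a2.ne, a3.ne], by simp, by simp, by simp, x12, x13, x23, a1, a2, a3,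
          b1, b2, b3, c1, c2, c3, uu, n1, n2, n3, hm1, hm2, hm3⟩
      exact vertexfix h
    · refine vertexfix (PM.pc_ext pcS (L := H) (p := v) (q := x₃) (c := m) ?_ ?_ ?_ ?_ ?_ ?_)
      · intro a b hab
        rw [PM.del_adj, Set.mem_singleton_iff]
        tauto
      · intro _ k; simp at k
      · intro w hw hw3
        exact hm2 w (PM.del_adj.1 hw).1 hw3
      · intro w hw hwv
        rcases n3 w (PM.del_adj.1 hw).1 with rfl | rfl
        · exact absurd rfl hwv
        · exact hm3
      · intro _; exact hm1
      · intro k; simp at k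
  · have h5 : vdeg H u₃ ≤ 4 + 1 := by have := hmax u₃; omega
    obtain ⟨cv, ce, pc⟩ := PM.pc_of_total (PM.del_colorable hmin b3
      ⟨v, le_antisymm ((hdeg' _ _ _).trans (hmax _)) (hv6 ▸ hdeg v x₃ u₃ a3.ne c3.symm)⟩)
    have pcS := pc.mono (L := H.deleteEdges {s(x₃, u₃)}) (T := {x₁, x₂, x₃}) (fun _ _ h => h)
      (Set.empty_subset _)
    obtain ⟨c, hc0, hc1, hc2⟩ := PM.missing b3.symm (k := 4) h5 cv ce {ce s(x₃, v)} (by simp)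
    refine vertexfix (PM.pc_ext pcS (L := H) (p := x₃) (q := u₃) (c := c) ?_ ?_ ?_ ?_ ?_ ?_)
    · intro a b hab
      rw [PM.del_adj, Set.mem_singleton_iff]
      tauto
    · intro k; simp at k
    · intro w hw hwu
      rcases n3 w (PM.del_adj.1 hw).1 with rfl | rfl
      · intro k; exact hc0 (by simp [k])
      · exact absurd rfl hwu
    · intro w hw hw3
      exact hc2 w (PM.del_adj.1 hw).1 hw3
    · intro k; simp at k
    · intro _; exact hc1
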